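/- Let N ≥ 1, S = {1,…,N}, p ∈ (0,1)^N with weights w_i = p_i/(1−p_i), let z be an integer with 0 ≤ z ≤ N, and fix d ∈ {0,1}^N with ∑_i d_i = z. Define L(p) = log( (∏_{i=1}^N w_i^{d_i}) / R(z, S) ), the log-PMF of the conditional Bernoulli model. Then for each i, ∂L/∂p_i = ((1+w_i)²/w_i)·(d_i − π_i), where π_i = w_i R(z−1, S∖{i}) / R(z, S). -/

import Mathlib

open Finset

/-- The R-function: `R(k, A) = ∑_{B ⊆ A, |B| = k} ∏_{i ∈ B} w i`, with
`R(0, A) = 1` and `R(k, A) = 0` for `k < 0` or `k > |A|`. -/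
noncomputable def Rfun {ι : Type*} [DecidableEq ι] (w : ι → ℝ) (k : ℤ) (A : Finset ι) : ℝ :=
  if k < 0 then 0 else ∑ B ∈ A.powersetCard k.toNat, ∏ i ∈ B, w i

/-- Bernoulli weights `w_j = p_j / (1 − p_j)`. -/
noncomputable def wOf {N : ℕ} (p : Fin N → ℝ) : Fin N → ℝ := fun j => p j / (1 - p j)

/-- First-order inclusion probability `π_i = w_i R(z−1, S∖{i}) / R(z, S)`. -/
noncomputable def piOf {N : ℕ} (p : Fin N → ℝ) (z : ℕ) (i : Fin N) : ℝ :=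
  wOf p i * Rfun (wOf p) ((z : ℤ) - 1) (Finset.univ.erase i) / Rfun (wOf p) (z : ℤ) Finset.univ

/-- The log-PMF of the conditional Bernoulli model:
`L(p) = log ((∏_i w_i^{d_i}) / R(z, S))`. -/
noncomputable def Lfun (N : ℕ) (z : ℕ) (d : Fin N → Fin 2) (p : Fin N → ℝ) : ℝ :=
  Real.log ((∏ j, wOf p j ^ (d j : ℕ)) / Rfun (wOf p) (z : ℤ) Finset.univ)

theorem Rfun_pos {ι : Type*} [DecidableEq ι] {w : ι → ℝ} (hw : ∀ i, 0 < w i) {k : ℕ}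
    {A : Finset ι} (hk : k ≤ A.card) : 0 < Rfun w (k : ℤ) A := by
  rw [Rfun, if_neg (by omega), Int.toNat_natCast]
  exact sum_pos (fun B _ => prod_pos fun i _ => hw i) (powersetCard_nonempty.2 hk)

theorem Rfun_congr {ι : Type*} [DecidableEq ι] {w v : ι → ℝ} (k : ℤ) {A : Finset ι}
    (h : ∀ i ∈ A, w i = v i) : Rfun w k A = Rfun v k A := by
  unfold Rfun
  split_ifs
  · rfl
  · exact sum_congr rfl fun B hB => prod_congr rfl fun i hi =>
      h i ((mem_powersetCard.1 hB).1 hi)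

/-- Pascal-type recursion for the R-function: split the subsets according to whether they
contain `i`. -/
theorem Rfun_insert {ι : Type*} [DecidableEq ι] (w : ι → ℝ) (k : ℕ) {i : ι} {A : Finset ι}
    (hi : i ∉ A) :
    Rfun w (k : ℤ) (insert i A) = Rfun w (k : ℤ) A + w i * Rfun w ((k : ℤ) - 1) A := by
  cases k with
  | zero => simp [Rfun]
  | succ n =>
    have hn : ((n + 1 : ℕ) : ℤ) - 1 = n := by push_cast; ring
    rw [hn, Rfun, Rfun, Rfun, if_neg (by omega), if_neg (by omega), if_neg (by omega),
      Int.toNat_natCast, Int.toNat_natCast, powersetCard_succ_insert hi, sum_union, sum_image,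
      mul_sum]
    · congr 1
      refine sum_congr rfl fun B hB => ?_
      exact prod_insert fun h => hi ((mem_powersetCard.1 hB).1 h)
    · intro B hB C hC h
      have hB' : i ∉ B := fun h => hi ((mem_powersetCard.1 hB).1 h)
      have hC' : i ∉ C := fun h => hi ((mem_powersetCard.1 hC).1 h)
      rw [← erase_insert hB', ← erase_insert hC', h]
    · rw [disjoint_left]
      intro B hB hB'
      obtain ⟨C, -, rfl⟩ := mem_image.1 hB'
      exact hi ((mem_powersetCard.1 hB).1 (mem_insert_self i C))

theorem wOf_pos {N : ℕ} {p : Fin N → ℝ} (hp : ∀ i, p i ∈ Set.Ioo (0 : ℝ) 1) (i : Fin N) :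
    0 < wOf p i :=
  div_pos (hp i).1 (sub_pos.2 (hp i).2)

theorem wOf_update_self {N : ℕ} (p : Fin N → ℝ) (i : Fin N) (t : ℝ) :
    wOf (Function.update p i t) i = t / (1 - t) := by
  simp [wOf]

theorem wOf_update_of_ne {N : ℕ} (p : Fin N → ℝ) {i j : Fin N} (h : j ≠ i) (t : ℝ) :
    wOf (Function.update p i t) j = wOf p j := by
  simp [wOf, h]

theorem Rfun_univ_eq {N : ℕ} (w : Fin N → ℝ) (z : ℕ) (i : Fin N) :
    Rfun w (z : ℤ) univ =
      Rfun w (z : ℤ) (univ.erase i) + w i * Rfun w ((z : ℤ) - 1) (univ.erase i) := by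
  rw [← Rfun_insert w z (notMem_erase i univ), insert_erase (mem_univ i)]

/-- As a function of the `i`-th coordinate alone, `L` depends only on the weight `t / (1 - t)`. -/
theorem Lfun_update {N : ℕ} (z : ℕ) (d : Fin N → Fin 2) (p : Fin N → ℝ) (i : Fin N) (t : ℝ) :
    Lfun N z d (Function.update p i t) =
      Real.log (((t / (1 - t)) ^ (d i : ℕ) * ∏ j ∈ univ.erase i, wOf p j ^ (d j : ℕ)) /
        (Rfun (wOf p) (z : ℤ) (univ.erase i) +
          t / (1 - t) * Rfun (wOf p) ((z : ℤ) - 1) (univ.erase i))) := by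
  have h : ∀ j ∈ univ.erase i, wOf (Function.update p i t) j = wOf p j :=
    fun j hj => wOf_update_of_ne p (ne_of_mem_erase hj) t
  rw [Lfun, Rfun_univ_eq _ z i, Rfun_congr _ h, Rfun_congr _ h, ← mul_prod_erase univ _ (mem_univ i),
    wOf_update_self, prod_congr rfl fun j hj => by rw [h j hj]]

theorem hasDerivAt_div_one_sub {x : ℝ} (hx : x < 1) :
    HasDerivAt (fun t : ℝ => t / (1 - t)) ((1 + x / (1 - x)) ^ 2) x := by
  have h1 : 1 - x ≠ 0 := (sub_pos.2 hx).ne'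
  refine ((hasDerivAt_id x).div ((hasDerivAt_id x).const_sub 1) h1).congr_deriv ?_
  simp only [id]
  field_simp
  ring

theorem hasDerivAt_log_pow_mul_div {w A B C : ℝ} (n : ℕ) (hw : 0 < w) (hC : 0 < C)
    (hR : 0 < A + w * B) :
    HasDerivAt (fun v : ℝ => Real.log (v ^ n * C / (A + v * B))) (n / w - B / (A + w * B)) w := by
  have hnum : HasDerivAt (fun v : ℝ => v ^ n * C) (n * w ^ (n - 1) * C) w :=
    (hasDerivAt_pow n w).mul_const C
  have hden : HasDerivAt (fun v : ℝ => A + v * B) B w := by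
    simpa using ((hasDerivAt_id w).mul_const B).const_add A
  have hpos : 0 < w ^ n * C := by positivity
  refine ((hnum.div hden hR.ne').log (div_pos hpos hR).ne').congr_deriv ?_
  cases n with
  | zero => simp; field_simp
  | succ m => simp only [Nat.add_sub_cancel, Pi.div_apply]; field_simp; ring

/-- for non-degenerate `p ∈ (0,1)^N`, `0 ≤ z ≤ N` and `d ∈ {0,1}^N` with
`∑ d_i = z`, one has `∂L/∂p_i = ((1+w_i)²/w_i)(d_i − π_i)`. -/
theorem stmt_11 (N : ℕ) (hN : 1 ≤ N) (p : Fin N → ℝ) (hp : ∀ i, p i ∈ Set.Ioo (0 : ℝ) 1)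
    (z : ℕ) (hz : z ≤ N) (d : Fin N → Fin 2) (hd : (∑ i, (d i : ℕ)) = z) (i : Fin N) :
    HasDerivAt (fun t : ℝ => Lfun N z d (Function.update p i t))
      ((1 + wOf p i) ^ 2 / wOf p i * (((d i : ℕ) : ℝ) - piOf p z i)) (p i) := by
  have hw := wOf_pos hp
  have hR : 0 < Rfun (wOf p) (z : ℤ) univ := Rfun_pos hw (by simpa using hz)
  have hC : 0 < ∏ j ∈ univ.erase i, wOf p j ^ (d j : ℕ) :=
    prod_pos fun j _ => pow_pos (hw j) _
  rw [piOf, funext (Lfun_update z d p i)]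
  rw [Rfun_univ_eq _ z i] at hR ⊢
  refine ((hasDerivAt_log_pow_mul_div (d i : ℕ) (hw i) hC hR).comp (p i)
    (hasDerivAt_div_one_sub (hp i).2)).congr_deriv ?_
  change _ * (1 + wOf p i) ^ 2 = _
  have hw' := (hw i).ne'
  field_simp
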